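/- arXiv:2405.00399 — 2 statements merged into one kernel-verified Lean document; each statement's English description precedes it below -/
import Mathlib

section
/- Assume 1 ≤ k < N and δ > 0. Then ‖u − F_k u‖_a ≤ 2 ‖u − p‖_a + (√μ̄_{k+1} / δ) ‖u − p‖_b. (Abstract form of the energy-norm estimate (2.10) of Theorem 2.3: the error of the discrete spectral projection of an exact eigenfunction is controlled by the projection errors with an explicit constant √μ̄_{k+1}/δ depending on the eigenvalues and their gap.) -/
open RealInnerProductSpace

section OrthonormalFamily

variable {W ι : Type*} [AddCommGroup W] [Module ℝ W] [DecidableEq ι]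

theorem LinearMap.BilinForm.sqrt_apply_add_le (a : LinearMap.BilinForm ℝ W)
    (hsymm : ∀ x y, a x y = a y x) (hnonneg : ∀ x, 0 ≤ a x x) (x y : W) :
    √(a (x + y) (x + y)) ≤ √(a x x) + √(a y y) := by
  have hcs : a x y ≤ √(a x x) * √(a y y) := by
    rw [← Real.sqrt_mul (hnonneg x)]
    exact Real.le_sqrt_of_sq_le (a.apply_sq_le_of_symm hnonneg ⟨hsymm⟩ x y)
  have hadd : a (x + y) (x + y) = a x x + 2 * a x y + a y y := by
    simp only [map_add, LinearMap.add_apply, hsymm y x]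
    ring
  refine Real.sqrt_le_iff.mpr ⟨by positivity, ?_⟩
  rw [hadd, add_sq, Real.sq_sqrt (hnonneg x), Real.sq_sqrt (hnonneg y)]
  linarith

/-- Pythagoras for the projection onto the span of finitely many members of an `a`-orthonormal
family. -/
theorem LinearMap.BilinForm.apply_sub_sum_self (a : LinearMap.BilinForm ℝ W)
    (hsymm : ∀ x y, a x y = a y x) {e : ι → W}
    (horth : ∀ i j, a (e i) (e j) = if i = j then 1 else 0) (s : Finset ι) (x : W) :
    a (x - ∑ j ∈ s, a x (e j) • e j) (x - ∑ j ∈ s, a x (e j) • e j) =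
      a x x - ∑ j ∈ s, a x (e j) ^ 2 := by
  have hcross : a x (∑ j ∈ s, a x (e j) • e j) = ∑ j ∈ s, a x (e j) ^ 2 := by
    simp [map_sum, sq]
  have hself : a (∑ j ∈ s, a x (e j) • e j) (∑ j ∈ s, a x (e j) • e j) =
      ∑ j ∈ s, a x (e j) ^ 2 := by
    simp only [map_sum, map_smul, LinearMap.sum_apply, LinearMap.smul_apply, smul_eq_mul, horth,
      mul_ite, mul_one, mul_zero]
    refine Finset.sum_congr rfl fun i hi => ?_
    simp [hi, sq]
  simp only [map_sub, LinearMap.sub_apply]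
  rw [hsymm (∑ j ∈ s, a x (e j) • e j) x, hcross, hself]
  ring

theorem LinearMap.BilinForm.linearIndependent_of_orthonormal (a : LinearMap.BilinForm ℝ W)
    {e : ι → W} (horth : ∀ i j, a (e i) (e j) = if i = j then 1 else 0) :
    LinearIndependent ℝ e := by
  rw [linearIndependent_iff']
  intro s g hg i hi
  have h := congrArg (fun y => a y (e i)) hg
  simpa [map_sum, horth, hi] using h

theorem LinearMap.BilinForm.sum_apply_smul_eq_of_finrank_eq [Fintype ι]
    (a : LinearMap.BilinForm ℝ W) {e : ι → W}
    (horth : ∀ i j, a (e i) (e j) = if i = j then 1 else 0) {H : Submodule ℝ W}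
    [FiniteDimensional ℝ H] (hmem : ∀ j, e j ∈ H) (hdim : Module.finrank ℝ H = Fintype.card ι)
    {p : W} (hp : p ∈ H) : ∑ j, a p (e j) • e j = p := by
  have hspan : Submodule.span ℝ (Set.range e) = H :=
    Submodule.eq_of_le_of_finrank_eq (Submodule.span_le.mpr (Set.range_subset_iff.mpr hmem))
      ((finrank_span_eq_card (a.linearIndependent_of_orthonormal horth)).trans hdim.symm)
  rw [← hspan] at hp
  obtain ⟨c, rfl⟩ := (Submodule.mem_span_range_iff_exists_fun ℝ).mp hp
  simp [map_sum, horth]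

end OrthonormalFamily

/-- Bessel's inequality for an orthogonal family whose squared norms are `(lam j)⁻¹`. -/
theorem sum_mul_inner_sq_le {W ι : Type*} [NormedAddCommGroup W] [InnerProductSpace ℝ W]
    [DecidableEq ι] {e : ι → W} {lam : ι → ℝ} (hlam : ∀ j, 0 < lam j)
    (horth : ∀ i j, lam i * ⟪e i, e j⟫ = if i = j then 1 else 0) (s : Finset ι) (x : W) :
    ∑ j ∈ s, lam j * ⟪e j, x⟫ ^ 2 ≤ ‖x‖ ^ 2 := by
  have hon : Orthonormal ℝ fun j => √(lam j) • e j := by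
    rw [orthonormal_iff_ite]
    intro i j
    rw [real_inner_smul_left, real_inner_smul_right]
    have h := horth i j
    split_ifs at h ⊢ with hij
    · subst hij
      rw [← mul_assoc, Real.mul_self_sqrt (hlam i).le, h]
    · rw [(mul_eq_zero.mp h).resolve_left (hlam i).ne', mul_zero, mul_zero]
  refine le_trans (le_of_eq (Finset.sum_congr rfl fun j _ => ?_))
    (hon.sum_inner_products_le (s := s) x)
  rw [real_inner_smul_left, Real.norm_eq_abs, sq_abs, mul_pow, Real.sq_sqrt (hlam j).le]

/-- abstract form of the energy-norm estimate (2.10) of Theorem 2.3.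
`‖u − F_k u‖_a ≤ 2‖u − p‖_a + (√μ̄_{k+1}/δ) ‖u − p‖_b`. -/
theorem eigenfunction_energy_estimate
    {W : Type*} [NormedAddCommGroup W] [InnerProductSpace ℝ W]
    (a : LinearMap.BilinForm ℝ W)
    (hsymm : ∀ x y : W, a x y = a y x)
    (hposdef : ∀ x : W, x ≠ 0 → 0 < a x x)
    (H : Submodule ℝ W) (N : ℕ) (hdim : Module.finrank ℝ H = N)
    (ubar : Fin N → W) (hmem : ∀ j, ubar j ∈ H)
    (lam : Fin N → ℝ) (hlampos : ∀ j, 0 < lam j) (hmono : Monotone lam)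
    (horth : ∀ i j, a (ubar i) (ubar j) = if i = j then 1 else 0)
    (heig : ∀ j, ∀ v ∈ H, a (ubar j) v = lam j * ⟪ubar j, v⟫)
    (lam0 : ℝ) (hlam0 : 0 < lam0) (u : W)
    (p : W) (hpH : p ∈ H)
    (hproj : ∀ v ∈ H, a p v = lam0 * ⟪u, v⟫)
    (k : ℕ) (hk1 : 1 ≤ k) (hkN : k < N)
    (F : W → W)
    (hF : ∀ w, F w = ∑ j ∈ Finset.univ.filter (fun j : Fin N => (j : ℕ) < k),
      a w (ubar j) • ubar j)
    (δ : ℝ)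
    (hδ : δ = sInf {r : ℝ | ∃ j : Fin N, k ≤ (j : ℕ) ∧ r = |(lam j)⁻¹ - lam0⁻¹|})
    (hδpos : 0 < δ) :
    Real.sqrt (a (u - F u) (u - F u)) ≤
      2 * Real.sqrt (a (u - p) (u - p)) +
        Real.sqrt ((lam ⟨k, hkN⟩)⁻¹) / δ * ‖u - p‖ := by
  have hnonneg : ∀ x, 0 ≤ a x x := fun x => by
    rcases eq_or_ne x 0 with rfl | hx
    · simp
    · exact (hposdef x hx).le
  have : FiniteDimensional ℝ H := Module.finite_of_finrank_pos (by omega)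
  set s := Finset.univ.filter (fun j : Fin N => (j : ℕ) < k) with hs
  have hgap : ∀ j ∈ sᶜ, δ ≤ |(lam j)⁻¹ - lam0⁻¹| := fun j hj => by
    rw [hδ]
    refine csInf_le ⟨0, ?_⟩ ⟨j, by simpa [hs] using hj, rfl⟩
    rintro r ⟨i, -, rfl⟩
    exact abs_nonneg _
  -- the coefficients of `p` are those of `u - p` divided by the spectral gaps
  have hcoef : ∀ j, (lam0⁻¹ - (lam j)⁻¹) * a p (ubar j) = ⟪ubar j, u - p⟫ := fun j => by
    have h₁ := hproj _ (hmem j)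
    have h₂ := heig j p hpH
    rw [hsymm] at h₂
    rw [inner_sub_right, sub_mul]
    nth_rewrite 1 [h₁]
    rw [h₂, inv_mul_cancel_left₀ hlam0.ne', inv_mul_cancel_left₀ (hlampos j).ne',
      real_inner_comm]
  have hcoef_le : ∀ j ∈ sᶜ, a p (ubar j) ^ 2 ≤
      (lam ⟨k, hkN⟩)⁻¹ / δ ^ 2 * (lam j * ⟪ubar j, u - p⟫ ^ 2) := fun j hj => by
    have hkj : lam ⟨k, hkN⟩ ≤ lam j := hmono (by simpa [hs, Fin.le_def] using hj)
    have hδsq : δ ^ 2 ≤ (lam0⁻¹ - (lam j)⁻¹) ^ 2 := by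
      rw [← sq_abs (lam0⁻¹ - (lam j)⁻¹), abs_sub_comm]
      exact pow_le_pow_left₀ hδpos.le (hgap j hj) 2
    have hone : 1 ≤ (lam ⟨k, hkN⟩)⁻¹ * lam j := by
      rwa [inv_mul_eq_div, one_le_div (hlampos _)]
    calc a p (ubar j) ^ 2 = 1 / δ ^ 2 * (δ ^ 2 * a p (ubar j) ^ 2) := by field_simp
      _ ≤ 1 / δ ^ 2 * ⟪ubar j, u - p⟫ ^ 2 := by
        rw [← hcoef, mul_pow]
        gcongr
      _ ≤ 1 / δ ^ 2 * (((lam ⟨k, hkN⟩)⁻¹ * lam j) * ⟪ubar j, u - p⟫ ^ 2) := by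
        gcongr
        exact le_mul_of_one_le_left (sq_nonneg _) hone
      _ = _ := by ring
  have hbessel : ∑ j ∈ sᶜ, lam j * ⟪ubar j, u - p⟫ ^ 2 ≤ ‖u - p‖ ^ 2 :=
    sum_mul_inner_sq_le hlampos (fun i j => by rw [← heig i _ (hmem j), horth]) _ _
  have hp : a (p - F p) (p - F p) = ∑ j ∈ sᶜ, a p (ubar j) ^ 2 := by
    have hfull := a.apply_sub_sum_self hsymm horth Finset.univ p
    rw [a.sum_apply_smul_eq_of_finrank_eq horth hmem (by simpa using hdim) hpH, sub_self,
      map_zero] at hfull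
    rw [hF, a.apply_sub_sum_self hsymm horth]
    have hsplit := Finset.sum_add_sum_compl s fun j => a p (ubar j) ^ 2
    linarith
  have hpF : √(a (p - F p) (p - F p)) ≤ √((lam ⟨k, hkN⟩)⁻¹) / δ * ‖u - p‖ := by
    have hμ : 0 ≤ (lam ⟨k, hkN⟩)⁻¹ := (inv_pos.mpr (hlampos _)).le
    refine Real.sqrt_le_iff.mpr ⟨by positivity, ?_⟩
    rw [hp, mul_pow, div_pow, Real.sq_sqrt hμ]
    refine (Finset.sum_le_sum hcoef_le).trans ?_
    rw [← Finset.mul_sum]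
    gcongr
  have herr : √(a (u - p - F (u - p)) (u - p - F (u - p))) ≤ √(a (u - p) (u - p)) := by
    rw [hF, a.apply_sub_sum_self hsymm horth]
    exact Real.sqrt_le_sqrt (sub_le_self _ (Finset.sum_nonneg fun _ _ => sq_nonneg _))
  have hdecomp : u - F u = (u - p - F (u - p)) + (p - F p) := by
    simp only [hF, map_sub, LinearMap.sub_apply, sub_smul, Finset.sum_sub_distrib]
    abel
  have htri := a.sqrt_apply_add_le hsymm hnonneg (u - p - F (u - p)) (p - F p)
  rw [← hdecomp] at htri
  linarith [Real.sqrt_nonneg (a (u - p) (u - p))]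
end

section
/- Assume δ_λ > 0 and that E_i is a contraction for the b-norm, i.e. ‖E_i w‖_b ≤ ‖w‖_b for all w ∈ W. Then ‖u − E_i u‖_b ≤ (2 + μ̄_1 / δ_λ) ‖u − p‖_b. (Abstract form of the L²-norm estimate (2.28) of Theorem 2.6 for a single eigenpair.) -/
open RealInnerProductSpace

/-- If the members of a subspace `H` are tested against an orthonormal family of `H` with
`finrank ℝ H` members, then a comparison of coefficients gives a comparison of norms. -/
theorem norm_le_mul_norm_of_abs_inner_le {W : Type*} [NormedAddCommGroup W]
    [InnerProductSpace ℝ W] {H : Submodule ℝ W} {ι : Type*} [Fintype ι] [Nonempty ι]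
    {e : ι → W} (he : Orthonormal ℝ e) (hmem : ∀ j, e j ∈ H)
    (hcard : Fintype.card ι = Module.finrank ℝ H) {z w : W} (hz : z ∈ H) {K : ℝ} (hK : 0 ≤ K)
    (h : ∀ j, |⟪e j, z⟫| ≤ K * |⟪e j, w⟫|) : ‖z‖ ≤ K * ‖w‖ := by
  let f : ι → H := fun j => ⟨e j, hmem j⟩
  have hf : Orthonormal ℝ f :=
    ⟨fun j => he.1 j, fun j k hjk => he.2 hjk⟩
  have hspan := hf.linearIndependent.span_eq_top_of_card_eq_finrank hcard
  have hpars := (OrthonormalBasis.mk hf hspan.ge).sum_sq_norm_inner_right ⟨z, hz⟩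
  simp only [OrthonormalBasis.coe_mk] at hpars
  have hbessel := he.sum_inner_products_le w (s := Finset.univ)
  refine (sq_le_sq₀ (norm_nonneg _) (by positivity)).1 ?_
  calc ‖z‖ ^ 2 = ∑ j, ‖⟪e j, z⟫‖ ^ 2 := hpars.symm
    _ ≤ ∑ j, K ^ 2 * ‖⟪e j, w⟫‖ ^ 2 := by
        gcongr with j
        rw [← mul_pow]
        exact pow_le_pow_left₀ (norm_nonneg _) (h j) 2
    _ = K ^ 2 * ∑ j, ‖⟪e j, w⟫‖ ^ 2 := (Finset.mul_sum ..).symm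
    _ ≤ K ^ 2 * ‖w‖ ^ 2 := by gcongr
    _ = (K * ‖w‖) ^ 2 := (mul_pow ..).symm

/-- abstract form of the `L²`-norm estimate (2.28) of Theorem 2.6.
If moreover `E_i` is a `b`-norm contraction, then
`‖u − E_i u‖_b ≤ (2 + μ̄_1/δ_λ) ‖u − p‖_b`. -/
theorem single_eigenfunction_b_estimate
    {W : Type*} [NormedAddCommGroup W] [InnerProductSpace ℝ W]
    (a : LinearMap.BilinForm ℝ W)
    (hsymm : ∀ x y : W, a x y = a y x)
    (hposdef : ∀ x : W, x ≠ 0 → 0 < a x x)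
    (H : Submodule ℝ W) (N : ℕ) (hdim : Module.finrank ℝ H = N)
    (ubar : Fin N → W) (hmem : ∀ j, ubar j ∈ H)
    (lam : Fin N → ℝ) (hlampos : ∀ j, 0 < lam j) (hmono : Monotone lam)
    (horth : ∀ i j, a (ubar i) (ubar j) = if i = j then 1 else 0)
    (heig : ∀ j, ∀ v ∈ H, a (ubar j) v = lam j * ⟪ubar j, v⟫)
    (lam0 : ℝ) (hlam0 : 0 < lam0) (u : W)
    (p : W) (hpH : p ∈ H)
    (hproj : ∀ v ∈ H, a p v = lam0 * ⟪u, v⟫)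
    (i : Fin N) (E : W → W)
    (hE : ∀ w, E w = a w (ubar i) • ubar i)
    (δl : ℝ)
    (hδl : δl = sInf {r : ℝ | ∃ j : Fin N, j ≠ i ∧ r = |(lam j)⁻¹ - lam0⁻¹|})
    (hδlpos : 0 < δl)
    (hcontr : ∀ w : W, ‖E w‖ ≤ ‖w‖) :
    ‖u - E u‖ ≤ (2 + (lam ⟨0, i.pos⟩)⁻¹ / δl) * ‖u - p‖ := by
  have hb : ∀ j, ∀ v ∈ H, ⟪ubar j, v⟫ = (lam j)⁻¹ * a (ubar j) v := fun j v hv => by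
    rw [heig j v hv, inv_mul_cancel_left₀ (hlampos j).ne']
  have he : Orthonormal ℝ fun j => √(lam j) • ubar j := by
    rw [orthonormal_iff_ite]
    intro j k
    rw [real_inner_smul_left, real_inner_smul_right, hb j _ (hmem k), horth]
    split_ifs with hjk
    · subst hjk
      rw [mul_one, ← mul_assoc, Real.mul_self_sqrt (hlampos j).le,
        mul_inv_cancel₀ (hlampos j).ne']
    · simp
  have hgap : ∀ j, j ≠ i → δl ≤ |(lam j)⁻¹ - lam0⁻¹| := fun j hj => by
    rw [hδl]
    refine csInf_le ⟨0, ?_⟩ ⟨j, hj, rfl⟩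
    rintro _ ⟨_, _, rfl⟩
    exact abs_nonneg _
  have hlam1 : 0 < (lam ⟨0, i.pos⟩)⁻¹ := inv_pos.2 (hlampos _)
  have hEp : E p ∈ H := by
    rw [hE]
    exact H.smul_mem _ (hmem i)
  have hmain : ‖p - E p‖ ≤ (lam ⟨0, i.pos⟩)⁻¹ / δl * ‖u - p‖ := by
    have : Nonempty (Fin N) := ⟨i⟩
    refine norm_le_mul_norm_of_abs_inner_le he (fun j => H.smul_mem _ (hmem j))
      (by rw [Fintype.card_fin, hdim]) (H.sub_mem hpH hEp) (by positivity) fun j => ?_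
    rw [real_inner_smul_left, real_inner_smul_left, abs_mul, abs_mul, mul_left_comm]
    refine mul_le_mul_of_nonneg_left ?_ (abs_nonneg _)
    have hz : ⟪ubar j, p - E p⟫
        = (lam j)⁻¹ * (a p (ubar j) - a p (ubar i) * if j = i then 1 else 0) := by
      rw [hb j _ (H.sub_mem hpH hEp), map_sub, hE, map_smul, horth, hsymm (ubar j) p, smul_eq_mul]
    rcases eq_or_ne j i with rfl | hj
    · rw [hz]
      simp only [if_true, mul_one, sub_self, mul_zero, abs_zero]
      positivity
    · have hw : ⟪ubar j, u - p⟫ = -((lam j)⁻¹ - lam0⁻¹) * a p (ubar j) := by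
        have hu : ⟪ubar j, u⟫ = lam0⁻¹ * a p (ubar j) := by
          rw [hproj _ (hmem j), inv_mul_cancel_left₀ hlam0.ne', real_inner_comm]
        rw [inner_sub_right, hu, hb j p hpH, hsymm (ubar j) p]
        ring
      have hle : (lam j)⁻¹ ≤ (lam ⟨0, i.pos⟩)⁻¹ :=
        inv_anti₀ (hlampos _) (hmono (Fin.mk_le_of_le_val (Nat.zero_le _)))
      rw [hz, hw, if_neg hj, mul_zero, sub_zero, abs_mul, abs_mul, abs_neg,
        abs_of_pos (inv_pos.2 (hlampos j)), ← mul_assoc]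
      refine mul_le_mul_of_nonneg_right ?_ (abs_nonneg _)
      calc (lam j)⁻¹ ≤ (lam ⟨0, i.pos⟩)⁻¹ := hle
        _ = (lam ⟨0, i.pos⟩)⁻¹ / δl * δl := (div_mul_cancel₀ _ hδlpos.ne').symm
        _ ≤ _ := mul_le_mul_of_nonneg_left (hgap j hj) (by positivity)
  have hsplit : u - E u = (u - p) + (p - E p) - E (u - p) := by
    simp only [hE, map_sub, LinearMap.sub_apply, sub_smul]
    abel
  calc ‖u - E u‖ ≤ ‖u - p‖ + ‖p - E p‖ + ‖E (u - p)‖ := by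
        rw [hsplit]
        exact (norm_sub_le _ _).trans (by gcongr; exact norm_add_le _ _)
    _ ≤ ‖u - p‖ + (lam ⟨0, i.pos⟩)⁻¹ / δl * ‖u - p‖ + ‖u - p‖ := by
        gcongr
        exact hcontr _
    _ = _ := by ring
end
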